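/- Let X = (X_1, …, X_8) be an 8-tuple of distinct variables in a polynomial ring P over F_q containing also the key variables k, and let v ∈ P^8 be any vector of polynomials of total degree at most 1. Then the vector h = A_8 · M_J^{−1} · (J_i(X, k) − v) ∈ P^8 satisfies: deg h_l ≤ 1 for 1 ≤ l ≤ 7, and h_8 has total degree 2 with homogeneous degree-2 part equal to f(X) = (Σ_{l=1}^{8} (−1)^{⌊(l−1)/4⌋} X_l)^2. Similarly, for 4-tuples of distinct variables y = (y_1,…,y_4), z = (z_1,…,z_4) and any vector v ∈ P^8 of polynomials of degree at most 1, the vector h' = B · M_R^{−1} · (R(y,z) − v) satisfies: deg h'_l ≤ 1 for l ∈ {1,2,3,5,6,7}, and h'_4, h'_8 have total degree 2 with homogeneous degree-2 parts equal to g(y,z) and g(z,y) respectively. -/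

import Mathlib

open MvPolynomial


variable {F : Type*} [Field F] {σ : Type*}

/-- Apply a square matrix over the coefficient field to a vector of polynomials. -/
noncomputable def matVec {n : ℕ} (M : Matrix (Fin n) (Fin n) F)
    (v : Fin n → MvPolynomial σ F) : Fin n → MvPolynomial σ F :=
  fun i => ∑ j, C (M i j) * v j

/-- The quadratic function `f(x₁, …, x₈) = (Σ_{l=1}^{8} (-1)^{⌊(l-1)/4⌋} x_l)²`
of the Hydra heads. -/
noncomputable def hydraf (x : Fin 8 → MvPolynomial σ F) : MvPolynomial σ F :=
  (∑ l : Fin 8, if l.1 < 4 then x l else - x l) ^ 2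

/-- The quadratic function
`g(y, z) = (Σ (-1)^{i-1} y_i) · (Σ (-1)^{⌊(i-1)/2⌋} z_i)` of the Hydra rolling
function. -/
noncomputable def hydrag (y z : Fin 4 → MvPolynomial σ F) : MvPolynomial σ F :=
  (∑ i : Fin 4, if i.1 % 2 = 0 then y i else - y i) *
    (∑ i : Fin 4, if i.1 < 2 then z i else - z i)

/-- Concatenation of two `4`-vectors of polynomials into an `8`-vector. -/
noncomputable def join8 (y z : Fin 4 → MvPolynomial σ F) : Fin 8 → MvPolynomial σ F :=
  fun i => if h : i.1 < 4 then y ⟨i.1, h⟩ else z ⟨i.1 - 4, by have := i.2; omega⟩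

/-- The extended key `k' = (k, M_E·k)`. -/
noncomputable def keyExt (ME : Matrix (Fin 4) (Fin 4) F)
    (k : Fin 4 → MvPolynomial σ F) : Fin 8 → MvPolynomial σ F :=
  join8 k (matVec ME k)

/-- The Hydra heads round function
`J_i(x, k) = M_J·(x_l + f(x))_l + k' + c^{(i)}`. -/
noncomputable def hydraJ (MJ : Matrix (Fin 8) (Fin 8) F) (ME : Matrix (Fin 4) (Fin 4) F)
    (ci : Fin 8 → F) (x : Fin 8 → MvPolynomial σ F) (k : Fin 4 → MvPolynomial σ F) :
    Fin 8 → MvPolynomial σ F :=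
  fun i => matVec MJ (fun l => x l + hydraf x) i + keyExt ME k i + C (ci i)

/-- The block diagonal matrix `diag(M, M) ∈ F^{8×8}` of a `4×4` matrix `M`. -/
def diagBlock (M : Matrix (Fin 4) (Fin 4) F) : Matrix (Fin 8) (Fin 8) F :=
  fun i j =>
    if hi : i.1 < 4 then
      (if hj : j.1 < 4 then M ⟨i.1, hi⟩ ⟨j.1, hj⟩ else 0)
    else
      (if hj : j.1 < 4 then 0
       else M ⟨i.1 - 4, by have := i.2; omega⟩ ⟨j.1 - 4, by have := j.2; omega⟩)

/-- The Hydra rolling function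
`R(y, z) = M_R·((y_i + g(y,z))_i, (z_i + g(z,y))_i)` with `M_R = diag(M_I, M_I)`. -/
noncomputable def hydraRoll (MI : Matrix (Fin 4) (Fin 4) F)
    (y z : Fin 4 → MvPolynomial σ F) : Fin 8 → MvPolynomial σ F :=
  matVec (diagBlock MI) (join8 (fun i => y i + hydrag y z) (fun i => z i + hydrag z y))

/-- The matrix `A_n`: the identity matrix except that the entries of the last
column above the diagonal are `-1`. -/
def Amat (n : ℕ) : Matrix (Fin n) (Fin n) F :=
  fun i j => if i = j then 1 else if j.1 = n - 1 then -1 else 0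

/-- Concatenation of two `4`-tuples of variables into an `8`-tuple. -/
def join8v {σ : Type*} (y z : Fin 4 → σ) : Fin 8 → σ :=
  fun i => if h : i.1 < 4 then y ⟨i.1, h⟩ else z ⟨i.1 - 4, by have := i.2; omega⟩

theorem matVec_add {n : ℕ} (M : Matrix (Fin n) (Fin n) F) (u v : Fin n → MvPolynomial σ F) :
    matVec M (u + v) = matVec M u + matVec M v := by
  funext i
  simp [matVec, mul_add, Finset.sum_add_distrib]

theorem matVec_matVec {n : ℕ} (M N : Matrix (Fin n) (Fin n) F)
    (v : Fin n → MvPolynomial σ F) : matVec M (matVec N v) = matVec (M * N) v := by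
  funext i
  simp only [matVec, Matrix.mul_apply, map_sum, map_mul, Finset.mul_sum, Finset.sum_mul]
  rw [Finset.sum_comm]
  simp only [mul_assoc]

theorem matVec_one {n : ℕ} (v : Fin n → MvPolynomial σ F) : matVec 1 v = v := by
  funext i
  simp [matVec, Matrix.one_apply]

theorem matVec_inv_matVec_add {n : ℕ} {M : Matrix (Fin n) (Fin n) F} (hM : IsUnit M.det)
    (u w : Fin n → MvPolynomial σ F) :
    matVec M⁻¹ (matVec M u + w) = u + matVec M⁻¹ w := by
  rw [matVec_add, matVec_matVec, Matrix.nonsing_inv_mul _ hM, matVec_one]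

theorem matVec_mem {n : ℕ} {W : Submodule F (MvPolynomial σ F)} (M : Matrix (Fin n) (Fin n) F)
    {v : Fin n → MvPolynomial σ F} (hv : ∀ i, v i ∈ W) (i : Fin n) : matVec M v i ∈ W := by
  refine W.sum_mem fun j _ => ?_
  rw [C_mul']
  exact W.smul_mem _ (hv j)

theorem join8_mem {W : Submodule F (MvPolynomial σ F)} {y z : Fin 4 → MvPolynomial σ F}
    (hy : ∀ i, y i ∈ W) (hz : ∀ i, z i ∈ W) (i : Fin 8) : join8 y z i ∈ W := by
  unfold join8
  split_ifs
  exacts [hy _, hz _]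

theorem matVec_Amat {n : ℕ} (u : Fin (n + 1) → MvPolynomial σ F) (l : Fin (n + 1)) :
    matVec (Amat (n + 1)) u l = if l = Fin.last n then u l else u l - u (Fin.last n) := by
  have hlast : ∀ i : Fin n, (i : ℕ) ≠ n := fun i => i.2.ne
  induction l using Fin.lastCases with
  | last =>
    simp [matVec, Amat, Fin.sum_univ_castSucc, hlast, (Fin.castSucc_lt_last _).ne']
  | cast l =>
    simp [matVec, Amat, Fin.sum_univ_castSucc, hlast, (Fin.castSucc_lt_last _).ne, apply_ite C,
      ite_mul, sub_eq_add_neg]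

theorem diagBlock_mul (M N : Matrix (Fin 4) (Fin 4) F) :
    diagBlock M * diagBlock N = diagBlock (M * N) := by
  ext i j
  refine Fin.addCases (m := 4) (n := 4) (fun a => ?_) (fun a => ?_) i <;>
  refine Fin.addCases (m := 4) (n := 4) (fun b => ?_) (fun b => ?_) j <;>
  simp [Matrix.mul_apply, diagBlock, Fin.sum_univ_add (a := 4) (b := 4)]

theorem diagBlock_one : diagBlock (1 : Matrix (Fin 4) (Fin 4) F) = 1 := by
  ext i j
  refine Fin.addCases (m := 4) (n := 4) (fun a => ?_) (fun a => ?_) i <;>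
  refine Fin.addCases (m := 4) (n := 4) (fun b => ?_) (fun b => ?_) j <;>
  simp [diagBlock, Matrix.one_apply, Fin.ext_iff] <;> omega

theorem isUnit_det_diagBlock {M : Matrix (Fin 4) (Fin 4) F} (hM : IsUnit M.det) :
    IsUnit (diagBlock M).det :=
  Matrix.isUnit_det_of_left_inverse (B := diagBlock M⁻¹) <| by
    rw [diagBlock_mul, Matrix.nonsing_inv_mul _ hM, diagBlock_one]

theorem matVec_diagBlock_join8 (M : Matrix (Fin 4) (Fin 4) F) (y z : Fin 4 → MvPolynomial σ F) :
    matVec (diagBlock M) (join8 y z) = join8 (matVec M y) (matVec M z) := by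
  funext i
  refine Fin.addCases (m := 4) (n := 4) (fun a => ?_) (fun a => ?_) i <;>
  simp [matVec, diagBlock, join8, Fin.sum_univ_add (a := 4) (b := 4)]

theorem matVec_Amat_add_const {n : ℕ} {W : Submodule F (MvPolynomial σ F)}
    {u : Fin (n + 1) → MvPolynomial σ F} (hu : ∀ i, u i ∈ W) (q : MvPolynomial σ F)
    {l : Fin (n + 1)} (hl : l ≠ Fin.last n) :
    matVec (Amat (n + 1)) (fun i => u i + q) l ∈ W := by
  rw [matVec_Amat, if_neg hl, add_sub_add_right_eq_sub]
  exact W.sub_mem (hu _) (hu _)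

theorem matVec_Amat_last {n : ℕ} (u : Fin (n + 1) → MvPolynomial σ F) :
    matVec (Amat (n + 1)) u (Fin.last n) = u (Fin.last n) := by
  rw [matVec_Amat, if_pos rfl]

theorem totalDegree_add_isHomogeneous {p q : MvPolynomial σ F} {n : ℕ}
    (hp : p.totalDegree < n) (hq : q.IsHomogeneous n) (hq0 : q ≠ 0) :
    (p + q).totalDegree = n := by
  have h := hq.totalDegree hq0
  rw [totalDegree_add_eq_right_of_totalDegree_lt (by rwa [h]), h]

theorem homogeneousComponent_add_isHomogeneous {p q : MvPolynomial σ F} {n : ℕ}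
    (hp : p.totalDegree < n) (hq : q.IsHomogeneous n) :
    homogeneousComponent n (p + q) = q := by
  rw [map_add, homogeneousComponent_eq_zero _ _ hp, zero_add, homogeneousComponent_of_mem hq,
    if_pos rfl]

theorem isHomogeneous_signed_sum {n : ℕ} (x : Fin n → σ) (P : Fin n → Prop) [DecidablePred P] :
    (∑ l, if P l then X (x l) else -X (x l) : MvPolynomial σ F).IsHomogeneous 1 := by
  refine IsHomogeneous.sum _ _ _ fun l _ => ?_
  split_ifs
  exacts [isHomogeneous_X _ _, (isHomogeneous_X _ _).neg]

theorem signed_sum_ne_zero {n : ℕ} {x : Fin (n + 1) → σ} (hx : Function.Injective x)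
    (P : Fin (n + 1) → Prop) [DecidablePred P] :
    (∑ l, if P l then X (x l) else -X (x l) : MvPolynomial σ F) ≠ 0 := by
  classical
  intro h
  have h' := congrArg (eval (Pi.single (x 0) 1)) h
  rw [map_sum, Finset.sum_eq_single 0 (fun l _ hl => ?_) (by simp)] at h'
  · split_ifs at h' <;> simp at h'
  · split_ifs <;> simp [hx.eq_iff, hl]

theorem isHomogeneous_hydraf (x : Fin 8 → σ) :
    (hydraf (fun i => X (x i)) : MvPolynomial σ F).IsHomogeneous 2 :=
  (isHomogeneous_signed_sum x _).pow 2

theorem hydraf_ne_zero {x : Fin 8 → σ} (hx : Function.Injective x) :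
    (hydraf (fun i => X (x i)) : MvPolynomial σ F) ≠ 0 :=
  pow_ne_zero 2 (signed_sum_ne_zero hx _)

theorem isHomogeneous_hydrag (y z : Fin 4 → σ) :
    (hydrag (fun i => X (y i)) (fun i => X (z i)) : MvPolynomial σ F).IsHomogeneous 2 :=
  (isHomogeneous_signed_sum y _).mul (isHomogeneous_signed_sum z _)

theorem hydrag_ne_zero {y z : Fin 4 → σ} (hy : Function.Injective y)
    (hz : Function.Injective z) :
    (hydrag (fun i => X (y i)) (fun i => X (z i)) : MvPolynomial σ F) ≠ 0 :=
  mul_ne_zero (signed_sum_ne_zero hy _) (signed_sum_ne_zero hz _)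

theorem join8v_injective_left {y z : Fin 4 → σ} (h : Function.Injective (join8v y z)) :
    Function.Injective y := by
  have : y = join8v y z ∘ Fin.castAdd 4 := by funext i; simp [join8v]
  rw [this]
  exact h.comp (Fin.castAdd_injective 4 4)

theorem join8v_injective_right {y z : Fin 4 → σ} (h : Function.Injective (join8v y z)) :
    Function.Injective z := by
  have : z = join8v y z ∘ Fin.natAdd 4 := by funext i; simp [join8v]
  rw [this]
  exact h.comp (Fin.natAdd_injective 4 4)

theorem matVec_inv_hydraJ_sub {W : Submodule F (MvPolynomial σ F)} (hC : ∀ a, C a ∈ W)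
    (ME : Matrix (Fin 4) (Fin 4) F) {MJ : Matrix (Fin 8) (Fin 8) F} (hMJ : IsUnit MJ.det)
    (ci : Fin 8 → F) {x : Fin 8 → MvPolynomial σ F} (hx : ∀ i, x i ∈ W)
    {k : Fin 4 → MvPolynomial σ F} (hk : ∀ i, k i ∈ W)
    {v : Fin 8 → MvPolynomial σ F} (hv : ∀ i, v i ∈ W) :
    ∃ u : Fin 8 → MvPolynomial σ F, (∀ i, u i ∈ W) ∧
      matVec MJ⁻¹ (fun m => hydraJ MJ ME ci x k m - v m) = fun i => u i + hydraf x := by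
  let w : Fin 8 → MvPolynomial σ F := fun i => keyExt ME k i + C (ci i) - v i
  have hw : ∀ i, w i ∈ W := fun i =>
    W.sub_mem (W.add_mem (join8_mem hk (matVec_mem ME hk) i) (hC _)) (hv i)
  refine ⟨fun i => x i + matVec MJ⁻¹ w i, fun i => W.add_mem (hx i) (matVec_mem _ hw i), ?_⟩
  have h : (fun m => hydraJ MJ ME ci x k m - v m) = matVec MJ (fun l => x l + hydraf x) + w := by
    funext m
    simp only [hydraJ, w, Pi.add_apply]
    ring
  rw [h, matVec_inv_matVec_add hMJ]
  funext i
  simp only [Pi.add_apply]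
  ring

theorem matVec_inv_hydraRoll_sub {W : Submodule F (MvPolynomial σ F)}
    {MI : Matrix (Fin 4) (Fin 4) F} (hMI : IsUnit MI.det)
    {y z : Fin 4 → MvPolynomial σ F} (hy : ∀ i, y i ∈ W) (hz : ∀ i, z i ∈ W)
    {v : Fin 8 → MvPolynomial σ F} (hv : ∀ i, v i ∈ W) :
    ∃ s t : Fin 4 → MvPolynomial σ F, (∀ i, s i ∈ W) ∧ (∀ i, t i ∈ W) ∧
      matVec (diagBlock MI)⁻¹ (fun m => hydraRoll MI y z m - v m) =
        join8 (fun i => s i + hydrag y z) (fun i => t i + hydrag z y) := by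
  let w : Fin 8 → MvPolynomial σ F := matVec (diagBlock MI)⁻¹ (-v)
  have hw : ∀ i, w i ∈ W := matVec_mem _ fun i => W.neg_mem (hv i)
  refine ⟨fun i => y i + w (Fin.castAdd 4 i), fun i => z i + w (Fin.natAdd 4 i),
    fun i => W.add_mem (hy i) (hw _), fun i => W.add_mem (hz i) (hw _), ?_⟩
  have h : (fun m => hydraRoll MI y z m - v m) = hydraRoll MI y z + -v := by
    funext m
    exact sub_eq_add_neg _ _
  rw [h, hydraRoll, matVec_inv_matVec_add (isUnit_det_diagBlock hMI)]
  funext i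
  refine Fin.addCases (m := 4) (n := 4) (fun a => ?_) (fun a => ?_) i <;>
  simp [join8, w, add_right_comm]

/-- After multiplying by `A₈ M_J⁻¹` (resp. `B M_R⁻¹`), the
Hydra head round (resp. rolling) equations have seven (resp. six) components of
degree at most `1`, while the remaining components have total degree `2` with
quadratic part `f(X)` (resp. `g(y,z)` and `g(z,y)`). -/
theorem hydra_round_transformation
    {F : Type*} [Field F] [Fintype F] {σ : Type*}
    (ME MI : Matrix (Fin 4) (Fin 4) F) (MJ : Matrix (Fin 8) (Fin 8) F)
    (hME : IsUnit ME.det) (hMI : IsUnit MI.det) (hMJ : IsUnit MJ.det)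
    (ci : Fin 8 → F)
    (Xv : Fin 8 → σ) (hXv : Function.Injective Xv)
    (kv : Fin 4 → σ)
    (v : Fin 8 → MvPolynomial σ F) (hv : ∀ l, (v l).totalDegree ≤ 1)
    (yv zv : Fin 4 → σ) (hyzv : Function.Injective (join8v yv zv))
    (v' : Fin 8 → MvPolynomial σ F) (hv' : ∀ l, (v' l).totalDegree ≤ 1) :
    (∀ l : Fin 8, l.1 < 7 →
      (matVec (Amat 8) (matVec MJ⁻¹
          (fun m => hydraJ MJ ME ci (fun m' => X (Xv m')) (fun j => X (kv j)) m - v m))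
        l).totalDegree ≤ 1) ∧
    (matVec (Amat 8) (matVec MJ⁻¹
        (fun m => hydraJ MJ ME ci (fun m' => X (Xv m')) (fun j => X (kv j)) m - v m))
      7).totalDegree = 2 ∧
    homogeneousComponent 2
        (matVec (Amat 8) (matVec MJ⁻¹
          (fun m => hydraJ MJ ME ci (fun m' => X (Xv m')) (fun j => X (kv j)) m - v m)) 7) =
      hydraf (fun m' => X (Xv m')) ∧
    (∀ l : Fin 8, l.1 ≠ 3 → l.1 ≠ 7 →
      (matVec (diagBlock (Amat 4)) (matVec (diagBlock MI)⁻¹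
          (fun m => hydraRoll MI (fun i => X (yv i)) (fun i => X (zv i)) m - v' m))
        l).totalDegree ≤ 1) ∧
    (matVec (diagBlock (Amat 4)) (matVec (diagBlock MI)⁻¹
        (fun m => hydraRoll MI (fun i => X (yv i)) (fun i => X (zv i)) m - v' m))
      3).totalDegree = 2 ∧
    homogeneousComponent 2
        (matVec (diagBlock (Amat 4)) (matVec (diagBlock MI)⁻¹
          (fun m => hydraRoll MI (fun i => X (yv i)) (fun i => X (zv i)) m - v' m)) 3) =
      hydrag (fun i => X (yv i)) (fun i => X (zv i)) ∧
    (matVec (diagBlock (Amat 4)) (matVec (diagBlock MI)⁻¹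
        (fun m => hydraRoll MI (fun i => X (yv i)) (fun i => X (zv i)) m - v' m))
      7).totalDegree = 2 ∧
    homogeneousComponent 2
        (matVec (diagBlock (Amat 4)) (matVec (diagBlock MI)⁻¹
          (fun m => hydraRoll MI (fun i => X (yv i)) (fun i => X (zv i)) m - v' m)) 7) =
      hydrag (fun i => X (zv i)) (fun i => X (yv i)) := by
  have hmem : ∀ p : MvPolynomial σ F, p ∈ restrictTotalDegree σ F 1 ↔ p.totalDegree ≤ 1 :=
    fun p => mem_restrictTotalDegree σ 1 p
  have hX : ∀ s : σ, (X s : MvPolynomial σ F) ∈ restrictTotalDegree σ F 1 := fun s =>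
    (hmem _).2 (totalDegree_X s).le
  obtain ⟨u, hu, hJ⟩ := matVec_inv_hydraJ_sub (W := restrictTotalDegree σ F 1)
    (fun a => (hmem _).2 (by simp)) ME hMJ ci (fun i => hX (Xv i)) (fun i => hX (kv i))
    (fun i => (hmem _).2 (hv i))
  obtain ⟨s, t, hs, ht, hR⟩ := matVec_inv_hydraRoll_sub (W := restrictTotalDegree σ F 1) hMI
    (fun i => hX (yv i)) (fun i => hX (zv i)) (fun i => (hmem _).2 (hv' i))
  have hlt : ∀ {p : MvPolynomial σ F}, p ∈ restrictTotalDegree σ F 1 → p.totalDegree < 2 :=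
    fun hp => Nat.lt_succ_of_le ((hmem _).1 hp)
  have hy := join8v_injective_left hyzv
  have hz := join8v_injective_right hyzv
  have hA (w : Fin 8 → MvPolynomial σ F) : matVec (Amat 8) w 7 = w 7 := matVec_Amat_last w
  have hB₃ (a b : Fin 4 → MvPolynomial σ F) : join8 (matVec (Amat 4) a) b 3 = a 3 :=
    matVec_Amat_last a
  have hB₇ (a b : Fin 4 → MvPolynomial σ F) : join8 a (matVec (Amat 4) b) 7 = b 3 :=
    matVec_Amat_last b
  rw [hJ, hR, matVec_diagBlock_join8, hA, hB₃, hB₇]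
  refine ⟨fun l hl => (hmem _).1 (matVec_Amat_add_const hu _ (Fin.ne_of_lt hl)),
    totalDegree_add_isHomogeneous (hlt (hu 7)) (isHomogeneous_hydraf Xv) (hydraf_ne_zero hXv),
    homogeneousComponent_add_isHomogeneous (hlt (hu 7)) (isHomogeneous_hydraf Xv),
    fun l hl₃ hl₇ => (hmem _).1 ?_,
    totalDegree_add_isHomogeneous (hlt (hs 3)) (isHomogeneous_hydrag yv zv) (hydrag_ne_zero hy hz),
    homogeneousComponent_add_isHomogeneous (hlt (hs 3)) (isHomogeneous_hydrag yv zv),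
    totalDegree_add_isHomogeneous (hlt (ht 3)) (isHomogeneous_hydrag zv yv) (hydrag_ne_zero hz hy),
    homogeneousComponent_add_isHomogeneous (hlt (ht 3)) (isHomogeneous_hydrag zv yv)⟩
  unfold join8
  split_ifs with h
  · exact matVec_Amat_add_const hs _ (by simpa [Fin.ext_iff] using hl₃)
  · exact matVec_Amat_add_const ht _ (by simp only [ne_eq, Fin.ext_iff, Fin.val_last]; omega)
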